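/- For every integer k ≥ 1, the 2-cocycle Φ_k is nontrivial in differential cohomology: there is no linear map T from sl(2) to polynomial differential operators F_{(1−k)/2} → F_{(1+k)/2} such that for all X, Y ∈ sl(2), Φ_k(X,Y) = L^{λ,μ}_X(T(Y)) − L^{λ,μ}_Y(T(X)) − T([X,Y]), where λ = (1−k)/2 and μ = (1+k)/2. -/

import Mathlib

open Polynomial

/-- The action `L^λ_{g d/dx}` of the vector field `g d/dx` on `λ`-densities `f dx^λ`:
`L^λ_{g d/dx}(f dx^λ) = (g f′ + λ g′ f) dx^λ`. -/
noncomputable def densityAct (lam : ℝ) (g f : Polynomial ℝ) : Polynomial ℝ :=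
  g * derivative f + lam • (derivative g * f)

/-- The 2-cocycle `Φ_k(g d/dx, h d/dx)(f dx^{(1−k)/2}) = (g′h″ − g″h′) f^{(k−1)} dx^{(1+k)/2}`. -/
noncomputable def Phi (k : ℕ) (g h f : Polynomial ℝ) : Polynomial ℝ :=
  (derivative g * derivative (derivative h) - derivative (derivative g) * derivative h)
    * derivative^[k - 1] f

/-- A differential operator with polynomial coefficients commutes with real scalars. -/
theorem map_smul_of_eq_sum_iterate_derivative {D : ℝ[X] → ℝ[X]} {N : ℕ} {p : ℕ → ℝ[X]}
    (hD : ∀ f, D f = ∑ i ∈ Finset.range (N + 1), p i * derivative^[i] f) (c : ℝ) (f : ℝ[X]) :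
    D (c • f) = c • D f := by
  simp only [hD, iterate_derivative_smul, mul_smul_comm, Finset.smul_sum]

theorem densityAct_X_X_pow (lam : ℝ) (n : ℕ) :
    densityAct lam X (X ^ n) = ((n : ℝ) + lam) • X ^ n := by
  cases n with
  | zero => simp [densityAct]
  | succ n =>
    simp only [densityAct, derivative_X, derivative_X_pow, smul_eq_C_mul]
    simp
    ring

theorem densityAct_X_sq_X_pow (lam : ℝ) (n : ℕ) :
    densityAct lam (X ^ 2) (X ^ n) = ((n : ℝ) + 2 * lam) • X ^ (n + 1) := by
  cases n with
  | zero =>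
    simp [densityAct, smul_eq_C_mul, C_ofNat]
    ring
  | succ n =>
    simp only [densityAct, derivative_X_pow, smul_eq_C_mul]
    simp
    ring

theorem coeff_zero_densityAct_X (lam : ℝ) (f : ℝ[X]) :
    (densityAct lam X f).coeff 0 = lam * f.coeff 0 := by
  simp [densityAct]

theorem coeff_zero_densityAct_X_sq (lam : ℝ) (f : ℝ[X]) :
    (densityAct lam (X ^ 2) f).coeff 0 = 0 := by
  simp [densityAct, mul_coeff_zero]

theorem coeff_zero_Phi_X_X_sq (n : ℕ) :
    (Phi (n + 1) X (X ^ 2) (X ^ n)).coeff 0 = 2 * (n.factorial : ℝ) := by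
  simp [Phi, mul_coeff_zero, iterate_derivative_X_pow_eq_natCast_mul, Nat.descFactorial_self,
    one_add_one_eq_two]

/-- For every `k ≥ 1`, the 2-cocycle `Φ_k` is nontrivial in differential cohomology:
there is no linear map `T` from `sl(2)` (polynomials of degree ≤ 2) to polynomial differential
operators `F_{(1−k)/2} → F_{(1+k)/2}` with
`Φ_k(X,Y) = L^{λ,μ}_X(T(Y)) − L^{λ,μ}_Y(T(X)) − T([X,Y])` for all `X, Y ∈ sl(2)`. -/
theorem stmt4 (k : ℕ) (hk : 1 ≤ k) :
    ¬ ∃ T : Polynomial ℝ → Polynomial ℝ → Polynomial ℝ,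
      -- T is ℝ-linear on sl(2)
      (∀ (a b : ℝ) (g h : Polynomial ℝ), g.degree ≤ 2 → h.degree ≤ 2 →
        T (a • g + b • h) = a • T g + b • T h) ∧
      -- each T(g d/dx) is a polynomial differential operator
      (∀ g : Polynomial ℝ, g.degree ≤ 2 → ∃ (N : ℕ) (p : ℕ → Polynomial ℝ),
        ∀ f : Polynomial ℝ, T g f = ∑ i ∈ Finset.range (N + 1), p i * derivative^[i] f) ∧
      -- Φ_k is the coboundary of T on sl(2)
      (∀ g h : Polynomial ℝ, g.degree ≤ 2 → h.degree ≤ 2 → ∀ f : Polynomial ℝ,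
        Phi k g h f =
          (densityAct ((1 + (k : ℝ)) / 2) g (T h f)
              - T h (densityAct ((1 - (k : ℝ)) / 2) g f))
            - (densityAct ((1 + (k : ℝ)) / 2) h (T g f)
              - T g (densityAct ((1 - (k : ℝ)) / 2) h f))
            - T (g * derivative h - derivative g * h) f) := by
  rintro ⟨T, -, hdiff, hcob⟩
  obtain ⟨n, rfl⟩ : ∃ n, k = n + 1 := ⟨k - 1, by omega⟩
  have hX : (X : ℝ[X]).degree ≤ 2 := degree_X_le.trans (by norm_num)
  have hX2 : (X ^ 2 : ℝ[X]).degree ≤ 2 := degree_X_pow_le 2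
  obtain ⟨_, _, hTX⟩ := hdiff X hX
  obtain ⟨_, _, hTX2⟩ := hdiff (X ^ 2) hX2
  have hbracket : (X * derivative (X ^ 2) - derivative X * X ^ 2 : ℝ[X]) = X ^ 2 := by
    simp
    ring
  -- Compare the constant terms of both sides on `X ^ (k - 1)`.
  have key := congrArg (coeff · 0) (hcob X (X ^ 2) hX hX2 (X ^ n))
  simp only [hbracket, densityAct_X_X_pow, densityAct_X_sq_X_pow,
    map_smul_of_eq_sum_iterate_derivative hTX, map_smul_of_eq_sum_iterate_derivative hTX2,
    coeff_sub, coeff_smul, smul_eq_mul, coeff_zero_densityAct_X, coeff_zero_densityAct_X_sq,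
    coeff_zero_Phi_X_X_sq] at key
  push_cast at key
  have hfac : (0 : ℝ) < n.factorial := mod_cast n.factorial_pos
  ring_nf at key
  linarith
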